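/- (Removal of nonlinear entries.) Let k, l be natural numbers with 1 ≤ k, and assume N · gcd(2k, M) ≤ M. Let δ = 1 if M divides 2·k·N and δ = 0 otherwise. Then for all ν, n ∈ S: 2^{−δ} · ( 𝟙[μ(n) − μ(ν) = −(k·N : ZMod M)] + 𝟙[μ(n) − μ(ν) = (k·N : ZMod M)] ) · Γ(L_{k,l} + (L_{k,l})ᴴ)[ν,n] = ω^{l·μ(n)} · 𝟙[ν = σ^k n] + ω^{−l·μ(ν)} · 𝟙[n = σ^k ν], where 𝟙[P] is 1 if P holds and 0 otherwise, and ω^{−l·μ(ν)} denotes the complex conjugate of ω^{l·μ(ν)}. -/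

import Mathlib

open Matrix Complex BigOperators Finset

noncomputable section

set_option linter.unusedVariables false

/-- `ω = exp(2πi/M)`. -/
def hwOmega (M : ℕ) : ℂ := Complex.exp (2 * Real.pi * Complex.I / M)

/-- Single-photon Heisenberg–Weyl matrix `L_{k,l} = X^k Z^l`,
with entries `L_{k,l}[m,m'] = ω^{l·m'}` if `m = m' + k` and `0` otherwise. -/
def HW (M : ℕ) [NeZero M] (k l : ZMod M) : Matrix (ZMod M) (ZMod M) ℂ :=
  Matrix.of fun m m' => if m = m' + k then hwOmega M ^ (l * m').val else 0

/-- Fock vectors: mode-occupation functions `ZMod M → ℕ` with total photon number `N`. -/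
abbrev Fock (M N : ℕ) [NeZero M] := {n : ZMod M → ℕ // ∑ m, n m = N}

instance (M N : ℕ) [NeZero M] : Fintype (Fock M N) :=
  Fintype.ofInjective
    (fun n (m : ZMod M) => (⟨n.1 m, Nat.lt_succ_of_le (le_of_le_of_eq
      (Finset.single_le_sum (fun i _ => Nat.zero_le _) (Finset.mem_univ m)) n.2)⟩ : Fin (N+1)))
    (fun a b h => Subtype.ext (funext fun m => congrArg Fin.val (congrFun h m)))

/-- The mode shift `σ`, `(σ n)(m) = n(m - 1)`. -/
def modeShift (M N : ℕ) [NeZero M] (n : Fock M N) : Fock M N :=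
  ⟨fun m => n.1 (m - 1), by
    exact (Fintype.sum_equiv (Equiv.subRight (1 : ZMod M)) _ _ (fun m => rfl)).trans n.2⟩

/-- The total mode index `μ(n) = ∑ m, m·n(m) ∈ ZMod M`. -/
def tmi (M N : ℕ) [NeZero M] (n : Fock M N) : ZMod M := ∑ m : ZMod M, m * (n.1 m : ZMod M)

/-- Multiphoton Heisenberg–Weyl matrix `Λ_{k,l}`, with entries `ω^{l·μ(n)}` at `(σ^k n, n)`
and `0` elsewhere. -/
def HWm (M N : ℕ) [NeZero M] (k l : ZMod M) : Matrix (Fock M N) (Fock M N) ℂ :=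
  Matrix.of fun v n =>
    if v = (modeShift M N)^[k.val] n then hwOmega M ^ (l * tmi M N n).val else 0

/-- `f : Fin N → ZMod M` enumerates the Fock vector `n`: each fiber `f⁻¹{m}` has `n(m)` elements. -/
def IsEnum (M N : ℕ) [NeZero M] (n : Fock M N) (f : Fin N → ZMod M) : Prop :=
  ∀ m : ZMod M, (Finset.univ.filter fun i => f i = m).card = n.1 m

/-- The permutations carrying `f` to `h`, two functions with equinumerous fibers, are counted by
the product of the factorials of the fiber cardinalities. -/
theorem card_perm_comp_eq {α ι : Type*} [Fintype α] [DecidableEq α] [Fintype ι] [DecidableEq ι]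
    (f h : α → ι) [DecidablePred fun σ : Equiv.Perm α => ∀ i, f (σ i) = h i]
    (hfh : ∀ m, (univ.filter fun i => f i = m).card = (univ.filter fun i => h i = m).card) :
    (univ.filter fun σ : Equiv.Perm α => ∀ i, f (σ i) = h i).card =
      ∏ m, ((univ.filter fun i => f i = m).card).factorial := by
  have e : ∀ m, Nonempty ({i // h i = m} ≃ {i // f i = m}) := fun m =>
    Fintype.card_eq.mp (by rw [Fintype.card_subtype, Fintype.card_subtype, hfh m])
  let τ : Equiv.Perm α := Equiv.ofFiberEquiv fun m => (e m).some
  have hτ : ∀ i, f (τ i) = h i := Equiv.ofFiberEquiv_map _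
  have hstab := DomMulAct.stabilizer_card f
  simp only [Fintype.card_subtype] at hstab
  rw [← hstab]
  refine Finset.card_equiv (Equiv.mulRight τ⁻¹) fun σ => ?_
  simp only [mem_filter, mem_univ, true_and, funext_iff, Function.comp_apply, Equiv.coe_mulRight,
    Equiv.Perm.mul_apply]
  constructor
  · intro hσ i
    rw [hσ, ← hτ, Equiv.Perm.inv_def, Equiv.apply_symm_apply]
  · intro hσ i
    rw [← hτ i, ← hσ (τ i), Equiv.Perm.inv_def, Equiv.symm_apply_apply]

theorem hwOmega_pow_self (M : ℕ) [NeZero M] : hwOmega M ^ M = 1 :=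
  (Complex.isPrimitiveRoot_exp M (NeZero.ne M)).pow_eq_one

theorem prod_hwOmega_pow_val (M : ℕ) [NeZero M] {α : Type*} (s : Finset α) (a : α → ZMod M) :
    ∏ i ∈ s, hwOmega M ^ (a i).val = hwOmega M ^ (∑ i ∈ s, a i).val := by
  have h : ∑ i ∈ s, a i = ((∑ i ∈ s, (a i).val : ℕ) : ZMod M) := by simp
  rw [prod_pow_eq_pow_sum, h, ZMod.val_natCast, pow_eq_pow_mod _ (hwOmega_pow_self M)]

theorem modeShift_iterate_apply (M N : ℕ) [NeZero M] (k : ℕ) (n : Fock M N) (m : ZMod M) :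
    ((modeShift M N)^[k] n).1 m = n.1 (m - k) := by
  induction k generalizing m with
  | zero => simp
  | succ k ih =>
    rw [Function.iterate_succ_apply']
    refine (ih (m - 1)).trans ?_
    rw [sub_sub, Nat.cast_succ, add_comm]

theorem IsEnum.sum_eq_tmi {M N : ℕ} [NeZero M] {n : Fock M N} {f : Fin N → ZMod M}
    (hf : IsEnum M N n f) : ∑ i, f i = tmi M N n := by
  rw [← Finset.sum_fiberwise univ f f]
  refine Finset.sum_congr rfl fun m _ => ?_
  rw [Finset.sum_congr rfl (fun i hi => (mem_filter.mp hi).2), sum_const, hf m, nsmul_eq_mul,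
    mul_comm]

/-- An enumeration of `n` translated by `k` enumerates `σ^k n`. -/
theorem IsEnum.add_natCast {M N : ℕ} [NeZero M] {n : Fock M N} {g : Fin N → ZMod M}
    (hg : IsEnum M N n g) (k : ℕ) :
    IsEnum M N ((modeShift M N)^[k] n) fun i => g i + k := by
  intro m
  rw [modeShift_iterate_apply, ← hg]
  simp only [eq_sub_iff_add_eq]

theorem permanent_HW {M N : ℕ} [NeZero M] (k l : ℕ) {ν n : Fock M N} {f g : Fin N → ZMod M}
    (hf : IsEnum M N ν f) (hg : IsEnum M N n g) :
    permanent (Matrix.of fun i j : Fin N => HW M (k : ZMod M) (l : ZMod M) (f i) (g j)) =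
      hwOmega M ^ ((l : ZMod M) * tmi M N n).val *
        if ν = (modeShift M N)^[k] n then ((∏ m, Nat.factorial (ν.1 m) : ℕ) : ℂ) else 0 := by
  have hperm : permanent (Matrix.of fun i j : Fin N => HW M (k : ZMod M) (l : ZMod M) (f i) (g j)) =
      hwOmega M ^ ((l : ZMod M) * tmi M N n).val *
        ((univ.filter fun σ : Equiv.Perm (Fin N) => ∀ i, f (σ i) = g i + k).card : ℂ) := by
    rw [← hg.sum_eq_tmi, mul_sum, ← prod_hwOmega_pow_val, permanent, ← Finset.sum_boole, mul_sum]
    refine Finset.sum_congr rfl fun σ _ => ?_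
    simp only [HW, Matrix.of_apply, Finset.prod_ite_zero, mem_univ, true_imp_iff, mul_ite, mul_one,
      mul_zero]
  rw [hperm]
  congr 1
  have hgk := hg.add_natCast k
  split_ifs with h
  · rw [card_perm_comp_eq f (fun i => g i + k) fun m => by rw [hf m, h, ← hgk m]]
    simp only [hf _]
  · rw [Nat.cast_eq_zero, card_eq_zero, filter_eq_empty_iff]
    intro σ _ hσ
    refine h (Subtype.ext (funext fun m => ?_))
    rw [← hf m, ← hgk m]
    refine (Finset.card_equiv σ fun i => ?_).symm
    simp [hσ]

theorem permanent_HW_conjTranspose {M N : ℕ} [NeZero M] (k l : ZMod M) (f g : Fin N → ZMod M) :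
    permanent (Matrix.of fun i j : Fin N => (HW M k l)ᴴ (f i) (g j)) =
      (starRingEnd ℂ) (permanent (Matrix.of fun i j : Fin N => HW M k l (g i) (f j))) := by
  rw [← permanent_transpose]
  simp [permanent, map_sum, map_prod]

/-- `M` divides `2kt` with `t ≤ N` only for `t = 0` or `t = N`. -/
theorem eq_zero_or_eq_of_dvd_two_mul {M N k t : ℕ} [NeZero M] (hkM : N * Nat.gcd (2 * k) M ≤ M)
    (ht : t ≤ N) (h : M ∣ 2 * k * t) : t = 0 ∨ t = N := by
  have hM : 0 < M := Nat.pos_of_neZero M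
  have hg : 0 < Nat.gcd (2 * k) M := Nat.gcd_pos_of_pos_right _ hM
  have hdvd : M ∣ Nat.gcd (2 * k) M * t := by
    rw [← Nat.gcd_mul_right]
    exact Nat.dvd_gcd h (dvd_mul_right M t)
  rcases Nat.eq_zero_or_pos t with h0 | h0
  · exact Or.inl h0
  · right
    have h1 := Nat.le_of_dvd (Nat.mul_pos hg h0) hdvd
    refine le_antisymm ht (le_of_mul_le_mul_left ?_ hg)
    linarith [mul_comm N (Nat.gcd (2 * k) M)]

/-- The scalar `2^{-δ} (𝟙[d = -kN] + 𝟙[d = kN])` filtering by the change `d` of the total mode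
index. -/
def indexFilter (M N k : ℕ) (d : ZMod M) : ℂ :=
  ((2 : ℂ) ^ (if M ∣ 2 * k * N then 1 else 0 : ℕ))⁻¹ *
    ((if d = -((k * N : ℕ) : ZMod M) then (1 : ℂ) else 0) +
      (if d = ((k * N : ℕ) : ZMod M) then (1 : ℂ) else 0))

theorem natCast_eq_neg_iff_dvd (M N k : ℕ) :
    ((k * N : ℕ) : ZMod M) = -((k * N : ℕ) : ZMod M) ↔ M ∣ 2 * k * N := by
  rw [← ZMod.natCast_eq_zero_iff, eq_neg_iff_add_eq_zero, ← Nat.cast_add]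
  ring_nf

theorem indexFilter_natCast (M N k : ℕ) : indexFilter M N k ((k * N : ℕ) : ZMod M) = 1 := by
  simp only [indexFilter, natCast_eq_neg_iff_dvd]
  split_ifs <;> norm_num

theorem indexFilter_neg_natCast (M N k : ℕ) :
    indexFilter M N k (-((k * N : ℕ) : ZMod M)) = 1 := by
  simp only [indexFilter, eq_comm (a := -((k * N : ℕ) : ZMod M)), natCast_eq_neg_iff_dvd]
  split_ifs <;> norm_num

/-- The filter annihilates the index change of a process in which `t` of the `N` photons are
shifted up and the others are shifted down, unless `t = 0` or `t = N`. -/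
theorem indexFilter_eq_zero {M N k t : ℕ} [NeZero M] (hkM : N * Nat.gcd (2 * k) M ≤ M)
    (ht : t ≤ N) (h0 : t ≠ 0) (hN : t ≠ N) {d : ZMod M}
    (hd : d = (k * N : ℕ) - (2 * k * t : ℕ)) : indexFilter M N k d = 0 := by
  have h1 : d ≠ ((k * N : ℕ) : ZMod M) := by
    intro h
    have : ((2 * k * t : ℕ) : ZMod M) = 0 := by linear_combination hd - h
    rcases eq_zero_or_eq_of_dvd_two_mul hkM ht ((ZMod.natCast_eq_zero_iff _ _).mp this) with h | h
    exacts [h0 h, hN h]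
  have h2 : d ≠ -((k * N : ℕ) : ZMod M) := by
    intro h
    have : ((2 * k * (N - t) : ℕ) : ZMod M) = 0 := by
      push_cast [Nat.cast_sub ht] at hd h ⊢
      linear_combination h - hd
    rcases eq_zero_or_eq_of_dvd_two_mul hkM (Nat.sub_le N t)
      ((ZMod.natCast_eq_zero_iff _ _).mp this) with h | h <;> omega
  rw [indexFilter, if_neg h1, if_neg h2, add_zero, mul_zero]

theorem indexFilter_mul_permanent {M N : ℕ} [NeZero M] (hN : 1 ≤ N) (k : ℕ)
    (hkM : N * Nat.gcd (2 * k) M ≤ M) (l : ZMod M) (f g : Fin N → ZMod M) :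
    indexFilter M N k (∑ i, g i - ∑ i, f i) *
        permanent (Matrix.of fun i j : Fin N => (HW M k l + (HW M k l)ᴴ) (f i) (g j)) =
      permanent (Matrix.of fun i j : Fin N => HW M k l (f i) (g j)) +
        permanent (Matrix.of fun i j : Fin N => (HW M k l)ᴴ (f i) (g j)) := by
  simp only [permanent, Matrix.of_apply, Matrix.add_apply, mul_sum]
  rw [← Finset.sum_add_distrib]
  refine Finset.sum_congr rfl fun σ _ => ?_
  rw [Fintype.prod_add, mul_sum]
  set F : Finset (Fin N) → ℂ := fun t =>
    (∏ i ∈ t, HW M k l (f (σ i)) (g i)) * ∏ i ∈ tᶜ, (HW M k l)ᴴ (f (σ i)) (g i) with hF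
  have hindex : ∀ t, F t ≠ 0 →
      ∑ i, g i - ∑ i, f i = (k * N : ℕ) - ((2 * k * t.card : ℕ) : ZMod M) := by
    intro t ht
    have hup : ∀ i ∈ t, f (σ i) = g i + k := by
      intro i hi
      by_contra hne
      exact prod_ne_zero_iff.mp (left_ne_zero_of_mul ht) i hi (by simp [HW, hne])
    have hdown : ∀ i ∈ tᶜ, f (σ i) = g i - k := by
      intro i hi
      by_contra hne
      refine prod_ne_zero_iff.mp (right_ne_zero_of_mul ht) i hi ?_
      simp only [HW, Matrix.conjTranspose_apply, Matrix.of_apply]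
      rw [if_neg fun h => hne (eq_sub_of_add_eq h.symm), star_zero]
    have hcard : ((tᶜ.card : ℕ) : ZMod M) = N - t.card := by
      rw [card_compl, Fintype.card_fin, Nat.cast_sub (by simpa using card_le_univ t)]
    rw [← Equiv.sum_comp σ f, ← sum_add_sum_compl t fun i => f (σ i), ← sum_add_sum_compl t g,
      sum_congr rfl hup, sum_congr rfl hdown, sum_add_distrib, sum_sub_distrib, sum_const,
      sum_const, nsmul_eq_mul, nsmul_eq_mul, hcard]
    push_cast
    ring
  have hne : (univ : Finset (Fin N)) ≠ ∅ := by
    have : NeZero N := ⟨by omega⟩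
    exact univ_nonempty.ne_empty
  have hterm : ∀ t, indexFilter M N k (∑ i, g i - ∑ i, f i) * F t =
      (if t = univ then F univ else 0) + if t = ∅ then F ∅ else 0 := by
    intro t
    by_cases ht : F t = 0
    · rw [ht, mul_zero]
      split_ifs <;> simp_all
    have hd := hindex t ht
    by_cases hu : t = univ
    · subst hu
      have : ∑ i, g i - ∑ i, f i = -((k * N : ℕ) : ZMod M) := by
        rw [hd, card_univ, Fintype.card_fin]
        push_cast
        ring
      rw [this, indexFilter_neg_natCast, if_pos rfl, if_neg hne, one_mul, add_zero]
    by_cases he : t = ∅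
    · subst he
      rw [hd, card_empty, mul_zero, Nat.cast_zero, sub_zero, indexFilter_natCast, if_neg hne.symm,
        if_pos rfl, one_mul, zero_add]
    rw [if_neg hu, if_neg he, add_zero,
      indexFilter_eq_zero hkM (by simpa using card_le_univ t) (card_ne_zero_of_mem
        (nonempty_iff_ne_empty.mpr he).choose_spec) ?_ hd, zero_mul]
    intro h
    exact hu ((card_eq_iff_eq_univ t).mp (by rw [h, Fintype.card_fin]))
  rw [Finset.sum_congr rfl fun t _ => hterm t, sum_add_distrib, Finset.sum_ite_eq',
    Finset.sum_ite_eq']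
  simp [hF]

theorem prod_factorial_modeShift_iterate (M N k : ℕ) [NeZero M] (n : Fock M N) :
    ∏ m, (((modeShift M N)^[k] n).1 m).factorial = ∏ m, (n.1 m).factorial := by
  simp only [modeShift_iterate_apply]
  exact Equiv.prod_comp (Equiv.subRight (k : ZMod M)) fun m => (n.1 m).factorial

theorem ite_prod_factorial_div_sqrt (M N k : ℕ) [NeZero M] (ν n : Fock M N) :
    (if ν = (modeShift M N)^[k] n then ((∏ m, Nat.factorial (ν.1 m) : ℕ) : ℂ) else 0) /
        (Real.sqrt (((∏ m, Nat.factorial (ν.1 m)) * ∏ m, Nat.factorial (n.1 m) : ℕ)) : ℂ) =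
      if ν = (modeShift M N)^[k] n then 1 else 0 := by
  split_ifs with h
  · have hpos : (∏ m, Nat.factorial (n.1 m)) ≠ 0 :=
      prod_ne_zero_iff.mpr fun m _ => Nat.factorial_ne_zero _
    rw [h, prod_factorial_modeShift_iterate, Nat.cast_mul, Real.sqrt_mul_self (Nat.cast_nonneg _),
      Complex.ofReal_natCast, div_self (Nat.cast_ne_zero.mpr hpos)]
  · rw [zero_div]

/-- removal of nonlinear entries: for `1 ≤ k` and `N·gcd(2k,M) ≤ M`, the
indicator-filtered `N`-photon matrix element of `L_{k,l} + (L_{k,l})ᴴ` restores linearity: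
it equals `ω^{lμ(n)} 𝟙[ν = σ^k n] + ω^{−lμ(ν)} 𝟙[n = σ^k ν]`. -/
theorem removal_of_nonlinear_entries (M N : ℕ) [NeZero M] (hN : 1 ≤ N) (k l : ℕ)
    (hk : 1 ≤ k) (hkM : N * Nat.gcd (2 * k) M ≤ M) (ν n : Fock M N)
    (f g : Fin N → ZMod M) (hf : IsEnum M N ν f) (hg : IsEnum M N n g) :
    ((2 : ℂ) ^ (if M ∣ 2 * k * N then 1 else 0 : ℕ))⁻¹ *
      ((if tmi M N n - tmi M N ν = -((k * N : ℕ) : ZMod M) then (1 : ℂ) else 0) +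
        (if tmi M N n - tmi M N ν = ((k * N : ℕ) : ZMod M) then (1 : ℂ) else 0)) *
      (Matrix.permanent (Matrix.of fun i j : Fin N =>
          (HW M (k : ZMod M) (l : ZMod M) + (HW M (k : ZMod M) (l : ZMod M))ᴴ) (f i) (g j)) /
        (Real.sqrt (((∏ m, Nat.factorial (ν.1 m)) * ∏ m, Nat.factorial (n.1 m) : ℕ)) : ℂ)) =
      hwOmega M ^ ((l : ZMod M) * tmi M N n).val *
          (if ν = (modeShift M N)^[k] n then (1 : ℂ) else 0) +
        (starRingEnd ℂ) (hwOmega M ^ ((l : ZMod M) * tmi M N ν).val) *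
          (if n = (modeShift M N)^[k] ν then (1 : ℂ) else 0) := by
  have hfilter := indexFilter_mul_permanent hN k hkM (l : ZMod M) f g
  rw [hf.sum_eq_tmi, hg.sum_eq_tmi, permanent_HW_conjTranspose, permanent_HW k l hf hg,
    permanent_HW k l hg hf, indexFilter] at hfilter
  rw [← mul_div_assoc, hfilter, add_div, mul_div_assoc, ite_prod_factorial_div_sqrt, map_mul,
    mul_div_assoc, apply_ite (starRingEnd ℂ), map_natCast, map_zero,
    mul_comm (∏ m, Nat.factorial (ν.1 m)), ite_prod_factorial_div_sqrt]

end
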